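/- For n ≥ 3, let M_3(n) denote the number of sequences (π_0, π_1, …, π_{n-1}) of permutations in S_3 that are realizable in the (1,3,n)-LRM scheme, i.e., that arise as the sequence of window permutations of some cyclic charge sequence c : Z/nZ → ℤ in which every three cyclically consecutive values c_i, c_{i+1}, c_{i+2} are pairwise distinct. Then M_3(n)/3^n tends to 1 as n tends to infinity. -/

import Mathlib

/-- A cyclic charge sequence `c : ZMod n → ℤ` has pairwise distinct values in every
window of three cyclically consecutive cells. -/
def DistinctWindows3 (n : ℕ) (c : ZMod n → ℤ) : Prop :=
  ∀ i : ZMod n, ∀ k l : Fin 3, k ≠ l →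
    c (i + ((k : ℕ) : ZMod n)) ≠ c (i + ((l : ℕ) : ZMod n))

/-- A sequence of permutations `π : ZMod n → S_3` is realizable in the `(1,3,n)`-LRM
scheme: there is a cyclic charge sequence `c` with pairwise distinct values in each
window of three cyclically consecutive cells such that `π i` lists the three positions
of the `i`-th window in order from the highest charge to the lowest, i.e. the cell at
(relative) position `π i k` in the window has higher charge than the one at position
`π i l` whenever `k < l`. -/
def Realizable3 (n : ℕ) (π : ZMod n → Equiv.Perm (Fin 3)) : Prop :=
  ∃ c : ZMod n → ℤ, DistinctWindows3 n c ∧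
    ∀ i : ZMod n, ∀ k l : Fin 3, k < l →
      c (i + ((π i k : ℕ) : ZMod n)) > c (i + ((π i l : ℕ) : ZMod n))

/-- `M₃ n` is the number of realizable sequences of permutations of `S_3`
in the `(1,3,n)`-LRM scheme. -/
noncomputable def M₃ (n : ℕ) : ℕ :=
  Nat.card {π : ZMod n → Equiv.Perm (Fin 3) // Realizable3 n π}

namespace LRM

def e (p : Equiv.Perm (Fin 3)) (a b : Fin 3) : ℤˣ := if p⁻¹ a < p⁻¹ b then 1 else -1
def S (p : Equiv.Perm (Fin 3)) : ℤˣ := e p 1 0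
def W (p : Equiv.Perm (Fin 3)) : Fin 3 :=
  if e p 2 1 = e p 1 0 then 0 else if e p 2 0 = e p 1 0 then 1 else 2
def χ (w : Fin 3) : ℤˣ := if w = 0 then 1 else -1
def τ (w : Fin 3) : ℤˣ := if w = 2 then -1 else 1
def r (w : Fin 3) : ℚ := if w = 0 then 1 else if w = 1 then -1/2 else -2

theorem e21 : ∀ p, e p 2 1 = S p * χ (W p) := by decide
theorem e20 : ∀ p, e p 2 0 = S p * τ (W p) := by decide
theorem e_swap : ∀ p a b, a ≠ b → e p b a = - e p a b := by decide
theorem e_lt : ∀ p (k l : Fin 3), k < l → e p (p k) (p l) = 1 := by decide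
theorem SW_inj : ∀ p q, S p = S q → W p = W q → p = q := by decide
theorem SW_surj : ∀ (s : ℤˣ) (w : Fin 3), ∃ p, S p = s ∧ W p = w := by decide

def LC (n : ℕ) (π : ZMod n → Equiv.Perm (Fin 3)) : Prop :=
  ∀ i, S (π (i + 1)) = S (π i) * χ (W (π i))

theorem e_iff {n : ℕ} {π : ZMod n → Equiv.Perm (Fin 3)} {c : ZMod n → ℤ}
    (h : ∀ i : ZMod n, ∀ k l : Fin 3, k < l →
      c (i + ((π i k : ℕ) : ZMod n)) > c (i + ((π i l : ℕ) : ZMod n)))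
    (i : ZMod n) (a b : Fin 3) (hab : a ≠ b) :
    e (π i) a b = if c (i + ((b : ℕ) : ZMod n)) < c (i + ((a : ℕ) : ZMod n)) then 1 else -1 := by
  unfold e
  rcases lt_or_gt_of_ne (fun h' => hab ((π i)⁻¹.injective h') : (π i)⁻¹ a ≠ (π i)⁻¹ b) with h1 | h1
  · have := h i _ _ h1
    rw [← Equiv.Perm.mul_apply, ← Equiv.Perm.mul_apply, mul_inv_cancel, Equiv.Perm.one_apply,
      Equiv.Perm.one_apply] at this
    rw [if_pos h1, if_pos this]
  · have := h i _ _ h1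
    rw [← Equiv.Perm.mul_apply, ← Equiv.Perm.mul_apply, mul_inv_cancel, Equiv.Perm.one_apply,
      Equiv.Perm.one_apply] at this
    rw [if_neg (not_lt.2 h1.le), if_neg (not_lt.2 this.le)]

theorem lc_of_realizable {n : ℕ} {π : ZMod n → Equiv.Perm (Fin 3)} (h : Realizable3 n π) :
    LC n π := by
  obtain ⟨c, -, h⟩ := h
  intro i
  rw [← e21, S, e_iff h _ _ _ (by decide), e_iff h _ _ _ (by decide)]
  have h2 : i + 1 + 1 = i + 2 := by ring
  simp [h2]

theorem chi_r (w : Fin 3) : 0 < ((χ w : ℤ) : ℚ) * r w := by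
  fin_cases w <;> simp [χ, r] <;> norm_num

theorem tau_r (w : Fin 3) : 0 < ((τ w : ℤ) : ℚ) * (1 + r w) := by
  fin_cases w <;> simp [τ, r] <;> norm_num

theorem lin (m : ℕ) (σ : ℕ → ℤˣ) (w : ℕ → Fin 3) (hσ : ∀ k, σ (k + 1) = σ k * χ (w k))
    (h0 : w m = 0) (h1 : w (m + 1) = 0) (h2 : w (m + 2) = 1) (h3 : w (m + 3) = 0)
    (h4 : w (m + 4) = 0) :
    ∃ C : ℕ → ℚ, ∀ k < m + 5,
      0 < ((σ k : ℤ) : ℚ) * (C ((k + 1) % (m + 5)) - C k) ∧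
      0 < ((σ k * τ (w k) : ℤˣ) : ℤ) * (C ((k + 2) % (m + 5)) - C k) := by
  let D : ℕ → ℚ := fun k => ((σ 0 : ℤ) : ℚ) * ∏ l ∈ Finset.range k, r (w l)
  let L : ℕ → ℚ := fun k => ∑ j ∈ Finset.range k, D j
  have hD : ∀ k, D (k + 1) = D k * r (w k) := fun k => by
    simp only [D, Finset.prod_range_succ]; ring
  have hL : ∀ k, L (k + 1) = L k + D k := fun k => by
    simp only [L, Finset.sum_range_succ]
  have hpos : ∀ k, 0 < ((σ k : ℤ) : ℚ) * D k := by
    intro k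
    induction k with
    | zero =>
      simp only [D]
      rcases Int.units_eq_one_or (σ 0) with h | h <;> simp [h]
    | succ k ih =>
      rw [hσ, hD]
      have := mul_pos ih (chi_r (w k))
      push_cast
      linarith
  have hpos2 : ∀ k, 0 < ((σ k * τ (w k) : ℤˣ) : ℤ) * (D k + D (k+1)) := by
    intro k
    have := mul_pos (hpos k) (tau_r (w k))
    rw [hD]
    push_cast
    linarith
  obtain ⟨M, hM⟩ : ∃ M : ℚ, ∀ k < m + 2, |L k| < M := by
    refine ⟨1 + ∑ k ∈ Finset.range (m + 2), |L k|, fun k hk => ?_⟩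
    have := Finset.single_le_sum (f := fun k => |L k|) (fun _ _ => abs_nonneg _)
      (Finset.mem_range.2 hk)
    linarith
  have c0 : χ 0 = 1 := rfl
  have c1 : χ 1 = -1 := rfl
  have t0 : τ 0 = 1 := rfl
  have t1 : τ 1 = 1 := rfl
  have s1 : σ (m + 1) = σ m := by rw [hσ, h0, c0, mul_one]
  have s2 : σ (m + 2) = σ m := by rw [hσ, h1, c0, mul_one, s1]
  have s3 : σ (m + 3) = - σ m := by rw [hσ, h2, c1, s2]; simp
  have s4 : σ (m + 4) = - σ m := by rw [hσ, h3, c0, mul_one, s3]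
  let ε : ℚ := ((σ m : ℤ) : ℚ)
  let C : ℕ → ℚ := fun k => if k < m + 2 then L k else if k = m + 2 then ε * M
    else if k = m + 3 then ε * (M + 2) else ε * (M + 1)
  have C0 : ∀ k < m + 2, C k = L k := fun k hk => by simp [C, hk]
  have C2 : C (m + 2) = ε * M := by simp [C]
  have C3 : C (m + 3) = ε * (M + 2) := by simp [C]
  have C4 : C (m + 4) = ε * (M + 1) := by simp [C]
  have hε : ε = 1 ∨ ε = -1 := by
    simp only [ε]
    rcases Int.units_eq_one_or (σ m) with h | h <;> simp [h]
  have hεL : ∀ k < m + 2, ∀ x, M ≤ x → 0 < ε * (ε * x - L k) := by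
    intro k hk x hx
    have := abs_lt.1 (hM k hk)
    rcases hε with h | h <;> rw [h] <;> linarith
  refine ⟨C, fun k hk => ?_⟩
  obtain hk | rfl | rfl | rfl | rfl | rfl : k < m ∨ k = m ∨ k = m + 1 ∨ k = m + 2 ∨ k = m + 3 ∨
    k = m + 4 := by omega
  · rw [Nat.mod_eq_of_lt (by omega), Nat.mod_eq_of_lt (by omega), C0 _ (by omega),
      C0 _ (by omega), C0 _ (by omega), hL (k + 1), hL k]
    have a := hpos k
    have b := hpos2 k
    constructor
    · convert a using 2; ring
    · convert b using 2; ring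
  · rw [Nat.mod_eq_of_lt (by omega), Nat.mod_eq_of_lt (by omega), C0 (k+1) (by omega),
      C0 k (by omega), C2, hL k, h0, t0, mul_one]
    constructor
    · convert hpos k using 2; ring
    · exact hεL k (by omega) M le_rfl
  · rw [Nat.mod_eq_of_lt (by omega), Nat.mod_eq_of_lt (by omega), C0 (m+1) (by omega),
      C2, C3, h1, t0, mul_one, s1]
    exact ⟨hεL _ (by omega) M le_rfl, hεL _ (by omega) _ (by linarith)⟩
  · rw [Nat.mod_eq_of_lt (by omega), Nat.mod_eq_of_lt (by omega), 
      C2, C3, C4, h2, t1, mul_one, s2]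
    change 0 < ε * _ ∧ 0 < ε * _
    rcases hε with h | h <;> rw [h] <;> constructor <;> linarith
  · rw [Nat.mod_eq_of_lt (by omega), show m + 3 + 2 = m + 5 by rfl, Nat.mod_self,
      C3, C4, C0 0 (by omega), h3, t0, mul_one, s3]
    push_cast
    change 0 < -ε * _ ∧ 0 < -ε * _
    have := hεL 0 (by omega) (M + 2) (by linarith)
    constructor
    · rcases hε with h | h <;> rw [h] <;> linarith
    · linarith
  · rw [show m + 4 + 1 = m + 5 by rfl, Nat.mod_self, show m + 4 + 2 = 1 + (m + 5) by ring,
      Nat.add_mod_right, Nat.mod_eq_of_lt (by omega : 1 < m + 5),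
      C4, C0 0 (by omega), C0 1 (by omega), h4, t0, mul_one, s4]
    push_cast
    change 0 < -ε * _ ∧ 0 < -ε * _
    have := hεL 0 (by omega) (M + 1) (by linarith)
    have := hεL 1 (by omega) (M + 1) (by linarith)
    constructor <;> linarith

theorem sign_lt {u : ℤˣ} {x y : ℚ} (h : 0 < ((u : ℤ) : ℚ) * (x - y)) (hu : u = 1) : y < x := by
  subst hu; simpa using h

theorem sign_ne {u : ℤˣ} {x y : ℚ} (h : 0 < ((u : ℤ) : ℚ) * (x - y)) : x ≠ y := by
  rintro rfl; simp at h

def Pat (n : ℕ) (w : ZMod n → Fin 3) (i : ZMod n) : Prop :=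
  w i = 0 ∧ w (i + 1) = 0 ∧ w (i + 2) = 1 ∧ w (i + 3) = 0 ∧ w (i + 4) = 0

theorem realizable_of (n : ℕ) (hn : 5 ≤ n) (π : ZMod n → Equiv.Perm (Fin 3)) (h : LC n π)
    (i : ZMod n) (hi : Pat n (fun j => W (π j)) i) : Realizable3 n π := by
  obtain ⟨m, rfl⟩ : ∃ m, n = m + 5 := ⟨n - 5, by omega⟩
  obtain ⟨h0, h1, h2, h3, h4⟩ := hi
  have hz : (m : ZMod (m + 5)) + 5 = 0 := by
    have := ZMod.natCast_self (m + 5)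
    push_cast at this; exact this
  have hb : ∀ x : ZMod (m + 5), i + 5 + (m + x) = i + x := fun x => by
    linear_combination hz
  obtain ⟨C, hC⟩ := lin m (fun k => S (π (i + 5 + k))) (fun k => W (π (i + 5 + k)))
    (fun k => by
      have := h (i + 5 + k)
      simpa [add_assoc] using this)
    (by have := hb 0; simp only [add_zero] at this; simp only [this]; exact h0)
    (by simp only [Nat.cast_add, hb]; simpa using h1)
    (by simp only [Nat.cast_add, hb]; simpa using h2)
    (by simp only [Nat.cast_add, hb]; simpa using h3)
    (by simp only [Nat.cast_add, hb]; simpa using h4)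
  let c : ZMod (m + 5) → ℚ := fun j => C (j - (i + 5)).val
  have hv : ∀ (j : ZMod (m + 5)) (a : ℕ), c (j + a) = C (((j - (i + 5)).val + a) % (m + 5)) := by
    intro j a
    simp only [c]
    congr 1
    rw [show j + a - (i + 5) = (j - (i + 5)) + a by ring, ZMod.val_add, ZMod.val_natCast,
      Nat.add_mod_mod]
  have hc0 : ∀ j, 0 < ((S (π j) : ℤ) : ℚ) * (c (j + 1) - c j) ∧
      0 < ((S (π j) * τ (W (π j)) : ℤˣ) : ℤ) * (c (j + 2) - c j) := by
    intro j
    have := hC (j - (i + 5)).val (ZMod.val_lt _)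
    simp only [ZMod.natCast_zmod_val, add_sub_cancel] at this
    have a := hv j 1
    have b := hv j 2
    push_cast at a b
    rw [a, b]
    exact this
  have hpairs : ∀ j, ∀ a b : Fin 3, a ≠ b →
      0 < ((e (π j) a b : ℤ) : ℚ) * (c (j + ((a : ℕ) : ZMod (m + 5))) - c (j + ((b : ℕ) : ZMod (m + 5)))) := by
    intro j
    have key : ∀ a b : Fin 3, b < a →
      0 < ((e (π j) a b : ℤ) : ℚ) * (c (j + ((a : ℕ) : ZMod (m + 5))) - c (j + ((b : ℕ) : ZMod (m + 5)))) := by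
      have a1 := (hc0 j).1
      have a2 := (hc0 j).2
      have a3 := (hc0 (j + 1)).1
      rw [h j, ← e21, show j + 1 + 1 = j + 2 by ring] at a3
      rw [← e20] at a2
      unfold S at a1
      intro a b hab
      fin_cases a <;> fin_cases b <;> first | (exact absurd hab (by decide)) | skip
      · simpa using a1
      · simpa using a2
      · simpa using a3
    intro a b hab
    rcases lt_or_gt_of_ne hab with hlt | hlt
    · have := key b a hlt
      rw [e_swap _ _ _ hab] at this
      push_cast at this
      linarith
    · exact key a b hlt
  let c' : ZMod (m + 5) → ℤ := fun j => ((Finset.univ.filter (fun l => c l < c j)).card : ℤ)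
  have hmono : ∀ x y, c x < c y → c' x < c' y := by
    intro x y hxy
    simp only [c']
    norm_cast
    apply Finset.card_lt_card
    rw [Finset.ssubset_iff_of_subset]
    · exact ⟨x, by simp [hxy], by simp⟩
    · intro l hl
      simp only [Finset.mem_filter, Finset.mem_univ, true_and] at hl ⊢
      exact hl.trans hxy
  refine ⟨c', ?_, ?_⟩
  · intro j k l hkl
    rcases lt_or_gt_of_ne (sign_ne (hpairs j k l hkl)) with h' | h'
    · exact (hmono _ _ h').ne
    · exact (hmono _ _ h').ne'
  · intro j k l hkl
    exact hmono _ _ (sign_lt (hpairs j _ _ (fun h' => hkl.ne ((π j).injective h')))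
      (e_lt _ _ _ hkl))

def Φ (n : ℕ) (π : ZMod n → Equiv.Perm (Fin 3)) : ℤˣ × (ZMod n → Fin 3) :=
  (S (π 0), fun i => W (π i))

theorem Φ_inj (n : ℕ) [NeZero n] {π ρ : ZMod n → Equiv.Perm (Fin 3)} (h1 : LC n π) (h2 : LC n ρ)
    (h : Φ n π = Φ n ρ) : π = ρ := by
  obtain ⟨h0, hw⟩ := Prod.ext_iff.1 h
  simp only [Φ] at h0 hw
  have hw' : ∀ i, W (π i) = W (ρ i) := fun i => congrFun hw i
  have hs : ∀ k : ℕ, S (π (k : ZMod n)) = S (ρ (k : ZMod n)) := by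
    intro k
    induction k with
    | zero => simpa using h0
    | succ k ih => push_cast; rw [h1, h2, ih, hw']
  funext i
  apply SW_inj _ _ _ (hw' i)
  have := hs i.val
  simpa using this

theorem LC_prod (n : ℕ) [NeZero n] {π : ZMod n → Equiv.Perm (Fin 3)} (h : LC n π) :
    ∏ i, χ (W (π i)) = 1 := by
  have h1 : ∏ i, S (π (i + 1)) = ∏ i, S (π i) :=
    Equiv.prod_comp (Equiv.addRight (1 : ZMod n)) (fun i => S (π i))
  simp only [h _, Finset.prod_mul_distrib] at h1
  simpa using h1

theorem Φ_surj (n : ℕ) [NeZero n] (s : ℤˣ) (w : ZMod n → Fin 3) (h : ∏ i, χ (w i) = 1) :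
    ∃ π, LC n π ∧ Φ n π = (s, w) := by
  let σ : ℕ → ℤˣ := fun k => s * ∏ j ∈ Finset.range k, χ (w (j : ZMod n))
  have hσ : ∀ k, σ (k + 1) = σ k * χ (w (k : ZMod n)) := fun k => by
    simp only [σ, Finset.prod_range_succ, mul_assoc]
  have hn : σ n = σ 0 := by
    simp only [σ, Finset.range_zero, Finset.prod_empty, mul_one]
    have : ∏ j ∈ Finset.range n, χ (w (j : ZMod n)) = ∏ i, χ (w i) := by
      refine Finset.prod_bij' (fun j _ => (j : ZMod n)) (fun i _ => i.val) ?_ ?_ ?_ ?_ ?_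
      · intros; simp
      · intro i _; simpa using ZMod.val_lt i
      · intro j hj; exact ZMod.val_cast_of_lt (Finset.mem_range.1 hj)
      · intro i _; simp
      · intros; rfl
    rw [this, h, mul_one]
  choose P hP1 hP2 using SW_surj
  refine ⟨fun i => P (σ i.val) (w i), ?_, ?_⟩
  · intro i
    simp only [hP1, hP2]
    have h1 : (i + 1).val = (i.val + 1) % n := by
      conv_lhs => rw [show i + 1 = ((i.val + 1 : ℕ) : ZMod n) by simp]
      rw [ZMod.val_natCast]
    have h2 : σ (i.val + 1) = σ i.val * χ (w i) := by rw [hσ]; simp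
    rw [← h2, h1]
    rcases lt_or_eq_of_le (Nat.succ_le_of_lt (ZMod.val_lt i)) with h3 | h3
    · rw [Nat.mod_eq_of_lt h3]
    · have h3 : i.val + 1 = n := h3
      rw [h3, Nat.mod_self, hn]
  · simp [Φ, hP1, hP2, σ]

theorem card_LC (n : ℕ) [NeZero n] :
    (Nat.card {π : ZMod n → Equiv.Perm (Fin 3) // LC n π} : ℤ) = 3 ^ n + (-1) ^ n := by
  classical
  let F : {π : ZMod n → Equiv.Perm (Fin 3) // LC n π} →
      ℤˣ × {w : ZMod n → Fin 3 // ∏ i, χ (w i) = 1} :=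
    fun π => (S (π.1 0), ⟨fun i => W (π.1 i), LC_prod n π.2⟩)
  have hF : Function.Bijective F := by
    constructor
    · intro a b hab
      apply Subtype.ext
      apply Φ_inj n a.2 b.2
      simp only [F, Prod.mk.injEq, Subtype.mk.injEq] at hab
      exact Prod.ext hab.1 hab.2
    · rintro ⟨s, w, hw⟩
      obtain ⟨π, h1, h2⟩ := Φ_surj n s w hw
      simp only [Φ, Prod.mk.injEq] at h2
      exact ⟨⟨π, h1⟩, by simp only [F, Prod.mk.injEq, Subtype.mk.injEq]; exact h2⟩
  rw [Nat.card_eq_of_bijective F hF, Nat.card_prod]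
  have h2 : Nat.card ℤˣ = 2 := by simp
  rw [h2, Nat.card_eq_fintype_card, Fintype.card_subtype]
  have key : ∑ w : ZMod n → Fin 3, (1 + ((∏ i, χ (w i) : ℤˣ) : ℤ)) =
      ∑ w : ZMod n → Fin 3, if ∏ i, χ (w i) = 1 then (2:ℤ) else 0 := by
    refine Finset.sum_congr rfl fun w _ => ?_
    rcases Int.units_eq_one_or (∏ i, χ (w i)) with h | h <;> rw [h] <;> decide
  have e1 : ∑ w : ZMod n → Fin 3, ((∏ i, χ (w i) : ℤˣ) : ℤ) = (-1) ^ n := by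
    have := Finset.prod_univ_sum (fun _ : ZMod n => (Finset.univ : Finset (Fin 3)))
      (fun _ a => ((χ a : ℤˣ) : ℤ))
    rw [Fintype.piFinset_univ] at this
    simp only [Units.coe_prod]
    rw [← this]
    have h3 : ∑ a : Fin 3, ((χ a : ℤˣ) : ℤ) = -1 := by decide
    rw [h3]; simp [ZMod.card]
  rw [Finset.sum_add_distrib, e1, ← Finset.sum_filter, Finset.sum_const, Finset.sum_const] at key
  simp [ZMod.card] at key
  push_cast
  linarith

def pat : Fin 5 → Fin 3 := ![0, 0, 1, 0, 0]

theorem card_avoid (n : ℕ) [NeZero n] :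
    Nat.card {w : ZMod n → Fin 3 // ∀ i, ¬ Pat n w i} ≤ 242 ^ (n / 5) * 3 ^ (n % 5) := by
  classical
  let G : {w : ZMod n → Fin 3 // ∀ i, ¬ Pat n w i} →
      (Fin (n / 5) → {v : Fin 5 → Fin 3 // v ≠ pat}) × (Fin (n % 5) → Fin 3) :=
    fun w => (fun j => ⟨fun t => w.1 ((5 * j.val + t.val : ℕ) : ZMod n), fun h => by
        apply w.2 ((5 * j.val : ℕ) : ZMod n)
        have h0 := congrFun h 0
        have h1 := congrFun h 1
        have h2 := congrFun h 2
        have h3 := congrFun h 3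
        have h4 := congrFun h 4
        simp [pat] at h0 h1 h2 h3 h4
        refine ⟨?_, ?_, ?_, ?_, ?_⟩ <;> push_cast <;> assumption⟩,
      fun t => w.1 ((5 * (n / 5) + t.val : ℕ) : ZMod n))
  have hG : Function.Injective G := by
    intro a b hab
    simp only [G, Prod.mk.injEq] at hab
    obtain ⟨h1, h2⟩ := hab
    apply Subtype.ext
    funext i
    have hi : ((5 * (i.val / 5) + i.val % 5 : ℕ) : ZMod n) = i := by
      rw [Nat.div_add_mod]; simp
    have hlt := ZMod.val_lt i
    by_cases hq : i.val / 5 < n / 5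
    · have := congrFun (congrArg Subtype.val (congrFun h1 ⟨i.val / 5, hq⟩))
        ⟨i.val % 5, Nat.mod_lt _ (by norm_num)⟩
      simp only [hi] at this
      exact this
    · have hq' : i.val / 5 = n / 5 := by omega
      have := congrFun h2 ⟨i.val % 5, by omega⟩
      simp only [← hq', hi] at this
      exact this
  have := Nat.card_le_card_of_injective G hG
  refine this.trans (le_of_eq ?_)
  rw [Nat.card_prod]
  simp [Nat.card_eq_fintype_card, Fintype.card_subtype_compl]

theorem card_bad (n : ℕ) [NeZero n] :
    Nat.card {π : ZMod n → Equiv.Perm (Fin 3) // LC n π ∧ ∀ i, ¬ Pat n (fun j => W (π j)) i} ≤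
      2 * (242 ^ (n / 5) * 3 ^ (n % 5)) := by
  let F : {π : ZMod n → Equiv.Perm (Fin 3) // LC n π ∧ ∀ i, ¬ Pat n (fun j => W (π j)) i} →
      ℤˣ × {w : ZMod n → Fin 3 // ∀ i, ¬ Pat n w i} :=
    fun π => (S (π.1 0), ⟨fun i => W (π.1 i), π.2.2⟩)
  have hF : Function.Injective F := by
    intro a b hab
    apply Subtype.ext
    apply Φ_inj n a.2.1 b.2.1
    simp only [F, Prod.mk.injEq, Subtype.mk.injEq] at hab
    exact Prod.ext hab.1 hab.2
  refine (Nat.card_le_card_of_injective F hF).trans ?_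
  rw [Nat.card_prod]
  have h2 : Nat.card ℤˣ = 2 := by simp
  rw [h2]
  exact Nat.mul_le_mul_left _ (card_avoid n)

theorem upper (n : ℕ) [NeZero n] : M₃ n ≤ Nat.card {π : ZMod n → Equiv.Perm (Fin 3) // LC n π} :=
  Nat.card_le_card_of_injective (fun π => ⟨π.1, lc_of_realizable π.2⟩)
    (fun a b h => Subtype.ext (by simpa using h))

theorem lower (n : ℕ) [NeZero n] (hn : 5 ≤ n) :
    Nat.card {π : ZMod n → Equiv.Perm (Fin 3) // LC n π} ≤ 
      M₃ n + 2 * (242 ^ (n / 5) * 3 ^ (n % 5)) := by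
  classical
  refine le_trans ?_ (Nat.add_le_add_left (card_bad n) _)
  unfold M₃
  change (Set.ncard {π | LC n π}) ≤ Set.ncard {π | Realizable3 n π} +
    Set.ncard {π | LC n π ∧ ∀ i, ¬ Pat n (fun j => W (π j)) i}
  refine le_trans (Set.ncard_le_ncard ?_ (Set.toFinite _)) (Set.ncard_union_le _ _)
  intro π hπ
  by_cases h : ∀ i, ¬ Pat n (fun j => W (π j)) i
  · exact Or.inr ⟨hπ, h⟩
  · push Not at h
    obtain ⟨i, hi⟩ := h
    exact Or.inl (realizable_of n hn π hπ i hi)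

end LRM

theorem m3_ratio_tendsto_one :
    Filter.Tendsto (fun n : ℕ => (M₃ n : ℝ) / 3 ^ n) Filter.atTop (nhds 1) := by
  have t1 : Filter.Tendsto (fun n : ℕ => (1 / 3 : ℝ) ^ n) Filter.atTop (nhds 0) :=
    tendsto_pow_atTop_nhds_zero_of_lt_one (by norm_num) (by norm_num)
  have t2 : Filter.Tendsto (fun n : ℕ => (242 / 243 : ℝ) ^ (n / 5)) Filter.atTop (nhds 0) :=
    (tendsto_pow_atTop_nhds_zero_of_lt_one (by norm_num) (by norm_num)).comp
      (Nat.tendsto_div_const_atTop (by norm_num))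
  have hu : Filter.Tendsto (fun n : ℕ => 1 + (1 / 3 : ℝ) ^ n) Filter.atTop (nhds 1) := by
    simpa using t1.const_add 1
  have hl : Filter.Tendsto (fun n : ℕ => 1 - (1 / 3 : ℝ) ^ n - 2 * (242 / 243 : ℝ) ^ (n / 5))
      Filter.atTop (nhds 1) := by
    simpa using (t1.const_sub 1).sub (t2.const_mul 2)
  have hb : ∀ n : ℕ, (-1 : ℝ) ^ n ≤ 1 ∧ -1 ≤ (-1 : ℝ) ^ n := fun n => by
    rcases neg_one_pow_eq_or ℝ n with h | h <;> rw [h] <;> norm_num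
  refine tendsto_of_tendsto_of_tendsto_of_le_of_le' hl hu ?_ ?_
  · filter_upwards [Filter.eventually_ge_atTop 5] with n hn
    have : NeZero n := ⟨by omega⟩
    have h1 : ((Nat.card {π : ZMod n → Equiv.Perm (Fin 3) // LRM.LC n π} : ℤ) : ℝ)
        = 3 ^ n + (-1) ^ n := by rw [LRM.card_LC n]; push_cast; rfl
    have h2 : (Nat.card {π : ZMod n → Equiv.Perm (Fin 3) // LRM.LC n π} : ℝ) ≤ 
      M₃ n + 2 * (242 ^ (n / 5) * 3 ^ (n % 5)) := by exact_mod_cast LRM.lower n hn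
    push_cast at h1
    have h3 : (3 : ℝ) ^ n = 243 ^ (n / 5) * 3 ^ (n % 5) := by
      rw [show (243 : ℝ) = 3 ^ 5 by norm_num, ← pow_mul, ← pow_add, Nat.div_add_mod]
    have h4 : (1 / 3 : ℝ) ^ n * 3 ^ n = 1 := by rw [← mul_pow]; norm_num
    have h5 : (242 / 243 : ℝ) ^ (n / 5) * 3 ^ n = 242 ^ (n / 5) * 3 ^ (n % 5) := by
      rw [h3, ← mul_assoc, ← mul_pow]; norm_num
    rw [le_div_iff₀ (by positivity), sub_mul, sub_mul, h4, mul_assoc, h5]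
    linarith [(hb n).2]
  · filter_upwards [Filter.eventually_ge_atTop 5] with n hn
    have : NeZero n := ⟨by omega⟩
    have h1 : ((Nat.card {π : ZMod n → Equiv.Perm (Fin 3) // LRM.LC n π} : ℤ) : ℝ)
        = 3 ^ n + (-1) ^ n := by rw [LRM.card_LC n]; push_cast; rfl
    have h2 : (M₃ n : ℝ) ≤ (Nat.card {π : ZMod n → Equiv.Perm (Fin 3) // LRM.LC n π} : ℝ) := by
      exact_mod_cast LRM.upper n
    push_cast at h1
    have h4 : (1 / 3 : ℝ) ^ n * 3 ^ n = 1 := by rw [← mul_pow]; norm_num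
    rw [div_le_iff₀ (by positivity), add_mul, h4]
    linarith [(hb n).1]
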